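/- Let v be a Barabanov norm with unit sphere S, and let Ω := ⋃ ω(x(·)), the union being over all v-extremal solutions x with v(x(t)) = 1 for all t ≥ 0. Assume there exist finitely many v-extremal solutions x₁, …, x_N on S such that Ω = ⋃_{i=1}^N ω(xᵢ(·)) and Ω is connected. Then the Barabanov norm is unique up to homogeneity: for every Barabanov norm w there exists λ > 0 with w = λ·v. -/

import Mathlib

open MeasureTheory Filter Topology RealInnerProductSpace Matrix

noncomputable section

abbrev Vec (n : ℕ) := EuclideanSpace ℝ (Fin n)

def mulE {n : ℕ} (A : Matrix (Fin n) (Fin n) ℝ) (y : Vec n) : Vec n :=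
  Matrix.toEuclideanLin A y

def IsSolutionWith {n : ℕ} (M : Set (Matrix (Fin n) (Fin n) ℝ))
    (A : ℝ → Matrix (Fin n) (Fin n) ℝ) (x : ℝ → Vec n) : Prop :=
  (∀ i j, Measurable fun t => A t i j) ∧ (∀ t, A t ∈ M) ∧
    ContinuousOn x (Set.Ici 0) ∧
    ∀ t ≥ (0:ℝ), x t = x 0 + ∫ s in (0:ℝ)..t, mulE (A s) (x s)

def IsSolution {n : ℕ} (M : Set (Matrix (Fin n) (Fin n) ℝ)) (x : ℝ → Vec n) : Prop :=
  ∃ A, IsSolutionWith M A x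

def IsAdjointWith {n : ℕ} (A : ℝ → Matrix (Fin n) (Fin n) ℝ) (l : ℝ → Vec n) : Prop :=
  ContinuousOn l (Set.Ici 0) ∧
    ∀ t ≥ (0:ℝ), l t = l 0 - ∫ s in (0:ℝ)..t, mulE ((A s)ᵀ) (l s)

def IsNorm {n : ℕ} (v : Vec n → ℝ) : Prop :=
  (∀ x, v x = 0 ↔ x = 0) ∧ (∀ (a : ℝ) (x : Vec n), v (a • x) = |a| * v x) ∧
    ∀ x y, v (x + y) ≤ v x + v y

def IsBarabanov {n : ℕ} (M : Set (Matrix (Fin n) (Fin n) ℝ)) (v : Vec n → ℝ) : Prop :=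
  IsNorm v ∧ (∀ x, IsSolution M x → ∀ t ≥ (0:ℝ), v (x t) ≤ v (x 0)) ∧
    ∀ y : Vec n, ∃ x, IsSolution M x ∧ x 0 = y ∧ ∀ t ≥ (0:ℝ), v (x t) = v y

def IsExtremal {n : ℕ} (M : Set (Matrix (Fin n) (Fin n) ℝ)) (v : Vec n → ℝ)
    (x : ℝ → Vec n) : Prop :=
  IsSolution M x ∧ ∀ t ≥ (0:ℝ), v (x t) = v (x 0)

def subdiff {n : ℕ} (v : Vec n → ℝ) (x : Vec n) : Set (Vec n) :=
  {l | ⟪l, x⟫ = v x ∧ ∀ y, ⟪l, y⟫ ≤ v y}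

def MIrreducible {n : ℕ} (M : Set (Matrix (Fin n) (Fin n) ℝ)) : Prop :=
  ∀ W : Submodule ℝ (Vec n), (∀ A ∈ M, ∀ x ∈ W, mulE A x ∈ W) → W = ⊥ ∨ W = ⊤

def rhoZero {n : ℕ} (M : Set (Matrix (Fin n) (Fin n) ℝ)) : Prop :=
  sSup {r : EReal | ∃ x, IsSolution M x ∧ x 0 ≠ 0 ∧
      r = limsup (fun t => ((Real.log ‖x t‖ / t : ℝ) : EReal)) atTop} = 0

def MaxCondWith {n : ℕ} (M : Set (Matrix (Fin n) (Fin n) ℝ))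
    (A : ℝ → Matrix (Fin n) (Fin n) ℝ) (x l : ℝ → Vec n) : Prop :=
  ∀ᵐ t ∂(volume.restrict (Set.Ici (0:ℝ))),
    ∀ B ∈ M, ⟪l t, mulE B (x t)⟫ ≤ ⟪l t, mulE (A t) (x t)⟫

def ConditionG {n : ℕ} (M : Set (Matrix (Fin n) (Fin n) ℝ)) : Prop :=
  ∀ (x₀ l₀ : Vec n), x₀ ≠ 0 → l₀ ≠ 0 →
  ∀ A₁ A₂ (x₁ x₂ l₁ l₂ : ℝ → Vec n),
    IsSolutionWith M A₁ x₁ → IsSolutionWith M A₂ x₂ →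
    IsAdjointWith A₁ l₁ → IsAdjointWith A₂ l₂ →
    x₁ 0 = x₀ → x₂ 0 = x₀ → l₁ 0 = l₀ → l₂ 0 = l₀ →
    MaxCondWith M A₁ x₁ l₁ → MaxCondWith M A₂ x₂ l₂ →
    ∀ t ≥ (0:ℝ), x₁ t = x₂ t ∧ l₁ t = l₂ t

def omegaLimitSet {n : ℕ} (x : ℝ → Vec n) : Set (Vec n) :=
  {p | ∃ tk : ℕ → ℝ, Tendsto tk atTop atTop ∧ Tendsto (fun k => x (tk k)) atTop (𝓝 p)}

def OmegaUnion {n : ℕ} (M : Set (Matrix (Fin n) (Fin n) ℝ)) (v : Vec n → ℝ) :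
    Set (Vec n) :=
  ⋃ x ∈ {x : ℝ → Vec n | IsSolution M x ∧ ∀ t ≥ (0:ℝ), v (x t) = 1}, omegaLimitSet x

theorem mulE_eq {n : ℕ} (A : Matrix (Fin n) (Fin n) ℝ) (y : Vec n) :
    mulE A y = WithLp.toLp 2 fun i => ∑ j, A i j * y j := by
  ext i
  simp [mulE, Matrix.mulVec, dotProduct]

theorem continuous_mulE {n : ℕ} :
    Continuous fun p : Matrix (Fin n) (Fin n) ℝ × Vec n => mulE p.1 p.2 := by
  simp only [mulE_eq]
  fun_prop

theorem IsSolutionWith.intervalIntegrable {n : ℕ} {M : Set (Matrix (Fin n) (Fin n) ℝ)}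
    (hM : IsCompact M) {A : ℝ → Matrix (Fin n) (Fin n) ℝ} {x : ℝ → Vec n}
    (hx : IsSolutionWith M A x) {a b : ℝ} (ha : 0 ≤ a) (hab : a ≤ b) :
    IntervalIntegrable (fun s => mulE (A s) (x s)) volume a b := by
  obtain ⟨hA, hAM, hxc, -⟩ := hx
  have hc : ContinuousOn x (Set.Icc a b) := hxc.mono fun t ht => ha.trans ht.1
  have hK : IsCompact (M ×ˢ (x '' Set.Icc a b)) :=
    hM.prod (isCompact_Icc.image_of_continuousOn hc)
  obtain ⟨C, hC⟩ := hK.exists_bound_of_continuousOn continuous_mulE.continuousOn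
  rw [intervalIntegrable_iff_integrableOn_Icc_of_le hab]
  refine IntegrableOn.of_bound (C := C) measure_Icc_lt_top ?_ ?_
  · have hxm : AEMeasurable x (volume.restrict (Set.Icc a b)) :=
      hc.aemeasurable measurableSet_Icc
    simp only [mulE_eq]
    refine AEMeasurable.aestronglyMeasurable ?_
    refine (WithLp.measurable_toLp 2 (Fin n → ℝ)).comp_aemeasurable
      (aemeasurable_pi_lambda _ fun i => Finset.aemeasurable_fun_sum _ fun j _ =>
        (hA i j).aemeasurable.mul ?_)
    exact (continuous_apply j |>.comp (PiLp.continuous_ofLp 2 _)).measurable.comp_aemeasurable hxm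
  · filter_upwards [ae_restrict_mem measurableSet_Icc] with s hs
    exact hC (A s, x s) ⟨hAM s, s, hs, rfl⟩

theorem IsSolution.shift {n : ℕ} {M : Set (Matrix (Fin n) (Fin n) ℝ)}
    (hM : IsCompact M) {x : ℝ → Vec n} (hx : IsSolution M x) {a : ℝ} (ha : 0 ≤ a) :
    IsSolution M fun t => x (t + a) := by
  obtain ⟨A, hxA⟩ := hx
  have hint := fun {b c : ℝ} => hxA.intervalIntegrable hM (a := b) (b := c)
  obtain ⟨hA, hAM, hxc, hxi⟩ := hxA
  refine ⟨fun t => A (t + a), fun i j => (hA i j).comp (measurable_add_const a),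
    fun t => hAM _, ?_, fun t ht => ?_⟩
  · exact hxc.comp (by fun_prop) fun t ht => add_nonneg ht ha
  · beta_reduce
    rw [intervalIntegral.integral_comp_add_right (fun s => mulE (A s) (x s)), zero_add,
      hxi (t + a) (add_nonneg ht ha), hxi a ha, add_assoc,
      intervalIntegral.integral_add_adjacent_intervals (hint le_rfl ha)
        (hint ha (le_add_of_nonneg_left ht))]

theorem IsNorm.nonneg {n : ℕ} {v : Vec n → ℝ} (hv : IsNorm v) (x : Vec n) : 0 ≤ v x := by
  have h := hv.2.2 x (-x)
  have h0 := (hv.1 0).2 rfl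
  have hneg := hv.2.1 (-1) x
  simp at hneg
  rw [add_neg_cancel, h0, hneg] at h
  linarith

theorem IsNorm.pos {n : ℕ} {v : Vec n → ℝ} (hv : IsNorm v) {x : Vec n} (hx : x ≠ 0) :
    0 < v x :=
  (hv.nonneg x).lt_of_ne' fun h => hx ((hv.1 x).1 h)

theorem IsNorm.continuous {n : ℕ} {v : Vec n → ℝ} (hv : IsNorm v) : Continuous v := by
  have h : ConvexOn ℝ Set.univ v := by
    refine ⟨convex_univ, fun x _ y _ a b ha hb _ => (hv.2.2 _ _).trans ?_⟩
    rw [hv.2.1, hv.2.1, abs_of_nonneg ha, abs_of_nonneg hb, smul_eq_mul, smul_eq_mul]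
  exact h.locallyLipschitz.continuous

theorem IsNorm.map_normalize {n : ℕ} {v : Vec n → ℝ} (hv : IsNorm v) (u : Vec n → ℝ)
    (hu : IsNorm u) (x : Vec n) : u ((v x)⁻¹ • x) = (v x)⁻¹ * u x := by
  rw [hu.2.1, abs_of_nonneg (inv_nonneg.2 (hv.nonneg x))]

theorem IsNorm.isCompact_sphere {n : ℕ} {v : Vec n → ℝ} (hv : IsNorm v) :
    IsCompact {x | v x = 1} := by
  refine Metric.isCompact_of_isClosed_isBounded
    (isClosed_eq hv.continuous continuous_const) ?_
  rcases (Metric.sphere (0 : Vec n) 1).eq_empty_or_nonempty with he | hne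
  · refine (Bornology.isBounded_singleton (x := (0 : Vec n))).subset fun x _ => ?_
    by_contra hx0
    have hx0 : x ≠ 0 := hx0
    have : ‖x‖⁻¹ • x ∈ Metric.sphere (0 : Vec n) 1 := by
      simp [norm_smul, hx0]
    simp [he] at this
  · obtain ⟨z, hz, hmin⟩ :=
      (_root_.isCompact_sphere (0 : Vec n) 1).exists_isMinOn hne hv.continuous.continuousOn
    have hz0 : z ≠ 0 := by
      rintro rfl
      simp at hz
    have hpos := hv.pos hz0
    refine (Metric.isBounded_closedBall (x := (0 : Vec n)) (r := (v z)⁻¹)).subset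
      fun x hx => ?_
    have hx : v x = 1 := hx
    have hx0 : x ≠ 0 := by
      rintro rfl
      rw [(hv.1 0).2 rfl] at hx
      exact zero_ne_one hx
    have h : v z ≤ v (‖x‖⁻¹ • x) := hmin (by simp [norm_smul, hx0])
    rw [hv.2.1, abs_of_nonneg (by positivity), hx, mul_one] at h
    rw [mem_closedBall_zero_iff]
    exact (le_inv_comm₀ hpos (norm_pos_iff.2 hx0)).1 h

theorem omegaLimitSet_nonempty {n : ℕ} {x : ℝ → Vec n} {K : Set (Vec n)} (hK : IsCompact K)
    (hx : ∀ t ≥ (0:ℝ), x t ∈ K) : (omegaLimitSet x).Nonempty := by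
  obtain ⟨p, -, φ, hφ, hp⟩ :=
    hK.tendsto_subseq (x := fun k : ℕ => x k) fun k => hx _ k.cast_nonneg
  exact ⟨p, fun k => (φ k : ℝ), tendsto_natCast_atTop_atTop.comp hφ.tendsto_atTop, hp⟩

/-- A Barabanov norm takes a single value on the limit set of a solution, and this value bounds
from below the norm along the solution. -/
theorem IsBarabanov.exists_eq_on_omegaLimitSet {n : ℕ} {M : Set (Matrix (Fin n) (Fin n) ℝ)}
    (hM : IsCompact M) {w : Vec n → ℝ} (hw : IsBarabanov M w) {x : ℝ → Vec n}
    (hx : IsSolution M x) : ∃ c ≤ w (x 0), ∀ p ∈ omegaLimitSet x, w p = c := by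
  have hanti : Antitone fun t => w (x (max t 0)) := by
    intro s t hst
    have h := hw.2.1 _ (hx.shift hM (le_max_right s 0)) (max t 0 - max s 0)
      (sub_nonneg.2 (max_le_max_right 0 hst))
    simpa using h
  have hbdd : BddBelow (Set.range fun t => w (x (max t 0))) :=
    ⟨0, by rintro _ ⟨t, rfl⟩; exact hw.1.nonneg _⟩
  have hlim := tendsto_atTop_ciInf hanti hbdd
  refine ⟨_, by simpa using ciInf_le hbdd 0, ?_⟩
  rintro p ⟨tk, htk, hp⟩
  refine tendsto_nhds_unique ((hw.1.continuous.tendsto p).comp hp)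
    ((hlim.comp htk).congr' ?_)
  filter_upwards [htk.eventually_ge_atTop 0] with k hk
  simp [max_eq_left hk]

theorem stmt8 (n : ℕ) (hn : 0 < n) (M : Set (Matrix (Fin n) (Fin n) ℝ))
    (hne : M.Nonempty) (hcpt : IsCompact M) (hconv : Convex ℝ M)
    (v : Vec n → ℝ) (hv : IsBarabanov M v)
    (N : ℕ) (hN : 0 < N) (xs : ℕ → ℝ → Vec n)
    (hxs : ∀ i < N, IsSolution M (xs i) ∧ ∀ t ≥ (0:ℝ), v (xs i t) = 1)
    (hΩ : OmegaUnion M v = ⋃ i ∈ Finset.range N, omegaLimitSet (xs i))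
    (hconn : IsConnected (OmegaUnion M v)) :
    ∀ w : Vec n → ℝ, IsBarabanov M w → ∃ lam > (0:ℝ), w = fun y => lam * v y := by
  intro w hw
  have hfin : (w '' OmegaUnion M v).Finite := by
    rw [hΩ, Set.image_iUnion₂]
    refine (Finset.range N).finite_toSet.biUnion fun i hi => ?_
    obtain ⟨c, -, hc⟩ := hw.exists_eq_on_omegaLimitSet hcpt (hxs i (by simpa using hi)).1
    exact (Set.finite_singleton c).subset (by rintro _ ⟨p, hp, rfl⟩; exact hc p hp)
  have hsub : (w '' OmegaUnion M v).Subsingleton :=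
    hfin.countable.isTotallyDisconnected _ subset_rfl
      (hconn.isPreconnected.image w hw.1.continuous.continuousOn)
  obtain ⟨q, hq⟩ := hconn.nonempty
  have hmem {x : ℝ → Vec n} (hx : IsSolution M x) (h1 : ∀ t ≥ (0:ℝ), v (x t) = 1)
      {p : Vec n} (hp : p ∈ omegaLimitSet x) : p ∈ OmegaUnion M v :=
    Set.mem_biUnion (show x ∈ {x : ℝ → Vec n | IsSolution M x ∧ ∀ t ≥ (0:ℝ), v (x t) = 1} from
      ⟨hx, h1⟩) hp
  have hS := hv.1.isCompact_sphere
  have hqS : v q = 1 := by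
    obtain ⟨x, hx, tk, htk, hp⟩ := Set.mem_iUnion₂.1 hq
    refine tendsto_nhds_unique ((hv.1.continuous.tendsto q).comp hp)
      (tendsto_const_nhds.congr' ?_)
    filter_upwards [htk.eventually_ge_atTop 0] with k hk
    exact (hx.2 _ hk).symm
  have hq0 : q ≠ 0 := by
    rintro rfl
    rw [(hv.1.1 0).2 rfl] at hqS
    exact zero_ne_one hqS
  have hlower (y : Vec n) (hy : v y = 1) : w q ≤ w y := by
    obtain ⟨x, hx, hx0, hxv⟩ := hv.2.2 y
    have h1 : ∀ t ≥ (0:ℝ), v (x t) = 1 := fun t ht => (hxv t ht).trans hy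
    obtain ⟨p, hp⟩ := omegaLimitSet_nonempty hS h1
    obtain ⟨c, hc, hcp⟩ := hw.exists_eq_on_omegaLimitSet hcpt hx
    rw [← hsub ⟨p, hmem hx h1 hp, rfl⟩ ⟨q, hq, rfl⟩, hcp p hp, ← hx0]
    exact hc
  obtain ⟨y, hy, hmax⟩ := hS.exists_isMaxOn ⟨q, hqS⟩ hw.1.continuous.continuousOn
  have hy : v y = 1 := hy
  have hbound (z : Vec n) (hz : z ≠ 0) : w z ≤ w y * v z := by
    have hvz := hv.1.pos hz
    have h : w ((v z)⁻¹ • z) ≤ w y := hmax (by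
      change v _ = 1
      rw [hv.1.map_normalize v hv.1, inv_mul_cancel₀ hvz.ne'])
    rwa [hv.1.map_normalize w hw.1, inv_mul_le_iff₀ hvz, mul_comm] at h
  have hy0 : y ≠ 0 := by
    rintro rfl
    rw [(hv.1.1 0).2 rfl] at hy
    exact zero_ne_one hy
  have hwy := hw.1.pos hy0
  -- A `w`-extremal solution starting at the maximum point is also `v`-extremal.
  have hmaxeq : w y = w q := by
    obtain ⟨x, hx, hx0, hxw⟩ := hw.2.2 y
    have h1 : ∀ t ≥ (0:ℝ), v (x t) = 1 := by
      intro t ht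
      refine le_antisymm (by simpa [hx0, hy] using hv.2.1 x hx t ht) ?_
      have hxt : x t ≠ 0 := by
        intro h
        have := hxw t ht
        rw [h, (hw.1.1 0).2 rfl] at this
        exact hwy.ne this
      have h := hbound (x t) hxt
      rw [hxw t ht] at h
      exact le_of_mul_le_mul_left (by simpa using h) hwy
    obtain ⟨p, hp⟩ := omegaLimitSet_nonempty hS h1
    rw [← hsub ⟨p, hmem hx h1 hp, rfl⟩ ⟨q, hq, rfl⟩]
    obtain ⟨tk, htk, hp⟩ := hp
    refine tendsto_nhds_unique (tendsto_const_nhds.congr' ?_)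
      ((hw.1.continuous.tendsto p).comp hp)
    filter_upwards [htk.eventually_ge_atTop 0] with k hk
    exact (hxw _ hk).symm
  refine ⟨w q, hw.1.pos hq0, funext fun z => ?_⟩
  rcases eq_or_ne z 0 with rfl | hz
  · rw [(hv.1.1 0).2 rfl, (hw.1.1 0).2 rfl, mul_zero]
  · have hvz := hv.1.pos hz
    refine le_antisymm (hmaxeq ▸ hbound z hz) ?_
    have h := hlower ((v z)⁻¹ • z) (by
      rw [hv.1.map_normalize v hv.1, inv_mul_cancel₀ hvz.ne'])
    rwa [hv.1.map_normalize w hw.1, le_inv_mul_iff₀ hvz, mul_comm] at h
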